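/- Let W = S_d with d ≥ 1, N = dim_k W, ρ = (n+1)(d−1), and let a be an integer with 0 ≤ ρ − a < d. Let B : ⋀^N W ⊗_k (S_{ρ−a})^* → ⋀^{N−n−1} W ⊗_k S_a be the Bezoutian contraction map (defined on (g_1∧⋯∧g_N) ⊗ φ as the signed sum over (n+1)-element subsets I of {1,…,N} of (⋀_{j∉I} g_j) ⊗ (φ⊗id)(Bez_{ρ−a,a}(g_I))), and let β : ⋀^{N−n} W ⊗_k S_{a−d} → ⋀^{N−n−1} W ⊗_k S_a be the Koszul contraction β((g_1∧⋯∧g_{N−n}) ⊗ p) = ∑_{j=1}^{N−n} (−1)^{j−1} (g_1∧⋯∧ĝ_j∧⋯∧g_{N−n}) ⊗ g_j·p. Then Im(B) ∩ Im(β) = {0}. -/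

import Mathlib

open MvPolynomial TensorProduct

noncomputable section

/-- The "mixed" variable assignment: variables with index `< j` are sent to the
`y`-variables (the second summand), variables with index `≥ j` to the `x`-variables
(the first summand). -/
def mixv (k : Type*) [Field k] (n : ℕ) (j : ℕ) :
    Fin (n + 1) → MvPolynomial (Fin (n + 1) ⊕ Fin (n + 1)) k :=
  fun i => if (i : ℕ) < j then X (Sum.inr i) else X (Sum.inl i)

/-- `D` is the `j`-th divided difference `Δ_j(f)` of `f`. -/
def IsDivDiff (k : Type*) [Field k] (n : ℕ) (f : MvPolynomial (Fin (n + 1)) k)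
    (j : Fin (n + 1)) (D : MvPolynomial (Fin (n + 1) ⊕ Fin (n + 1)) k) : Prop :=
  D * (X (Sum.inl j) - X (Sum.inr j)) =
    aeval (mixv k n (j : ℕ)) f - aeval (mixv k n ((j : ℕ) + 1)) f

/-- Writing `Q ∈ k[x_0,…,x_n,y_0,…,y_n]` as `∑_α Q_α(x) y^α`, this is the coefficient
`Q_α(x) ∈ k[x_0,…,x_n]` of the monomial `y^α`. -/
def coeffY (k : Type*) [Field k] (n : ℕ) (Q : MvPolynomial (Fin (n + 1) ⊕ Fin (n + 1)) k)
    (α : Fin (n + 1) →₀ ℕ) : MvPolynomial (Fin (n + 1)) k :=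
  MvPolynomial.coeff α ((sumAlgEquiv k (Fin (n + 1)) (Fin (n + 1))) (rename Sum.swap Q))

/-- The `ℤ`-indexed graded piece `S_m ⊆ S = k[x_0,…,x_n]` (zero in negative degrees). -/
def gradedPiece (k : Type*) [Field k] (n : ℕ) (m : ℤ) :
    Submodule k (MvPolynomial (Fin (n + 1)) k) :=
  if 0 ≤ m then homogeneousSubmodule (Fin (n + 1)) k m.toNat else ⊥


/-- Membership in a graded piece of nonnegative degree. -/
theorem mem_gp {k : Type*} [Field k] {n : ℕ} (m : ℕ) (p : MvPolynomial (Fin (n + 1)) k) :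
    p ∈ gradedPiece k n (m : ℤ) ↔ p.IsHomogeneous m := by
  simp [gradedPiece]

theorem gp_neg {k : Type*} [Field k] {n : ℕ} {m : ℤ} (hm : m < 0) :
    gradedPiece k n m = ⊥ := by
  simp [gradedPiece, hm]

theorem monomial_mem_gp {k : Type*} [Field k] {n : ℕ} (m : ℤ) (α : Fin (n + 1) →₀ ℕ)
    (h : ((∑ i, α i : ℕ) : ℤ) = m) : monomial α (1 : k) ∈ gradedPiece k n m := by
  subst h
  rw [mem_gp]
  apply isHomogeneous_monomial
  rw [Finsupp.degree_eq_sum]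

theorem mul_mem_gp {k : Type*} [Field k] {n d : ℕ} {a : ℤ} {g p : MvPolynomial (Fin (n + 1)) k}
    (hg : g ∈ gradedPiece k n d) (hp : p ∈ gradedPiece k n (a - d)) :
    g * p ∈ gradedPiece k n a := by
  rcases lt_or_ge (a - d) 0 with h | h
  · rw [gp_neg h, Submodule.mem_bot] at hp
    simp [hp]
  · obtain ⟨e, he⟩ := Int.eq_ofNat_of_zero_le h
    rw [he] at hp
    obtain rfl : a = ((d + e : ℕ) : ℤ) := by push_cast; omega
    rw [mem_gp] at *
    exact hg.mul hp

/-- Basis of monomials of degree `d`. -/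
theorem exists_gp_basis (k : Type*) [Field k] (n d : ℕ) :
    ∃ (e : Fin ((n + d).choose d) ≃ {m : Fin (n + 1) →₀ ℕ // ∑ i, m i = d})
      (b : Module.Basis (Fin ((n + d).choose d)) k (gradedPiece k n d)),
      ∀ j, (b j : MvPolynomial (Fin (n + 1)) k) = monomial (e j : Fin (n + 1) →₀ ℕ) 1 := by
  have hT : ∀ m : Fin (n + 1) →₀ ℕ,
      m ∈ (Finset.univ : Finset (Fin (n + 1))).finsuppAntidiag d ↔ ∑ i, m i = d := by
    intro m; simp [Finset.mem_finsuppAntidiag]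
  have hcard : Fintype.card ((Finset.univ : Finset (Fin (n + 1))).finsuppAntidiag d)
      = (n + d).choose d := by
    rw [Fintype.card_coe, Finset.card_finsuppAntidiag_nat_eq_choose, Finset.card_univ,
      Fintype.card_fin]
    congr 1; omega
  let e0 : Fin ((n + d).choose d) ≃ {m : Fin (n + 1) →₀ ℕ // ∑ i, m i = d} :=
    (Fintype.equivFinOfCardEq hcard).symm.trans (Equiv.subtypeEquivRight hT)
  refine ⟨e0, ?_⟩
  let v : Fin ((n + d).choose d) → gradedPiece k n d := fun j =>
    ⟨monomial (e0 j : Fin (n + 1) →₀ ℕ) 1, monomial_mem_gp _ _ (by rw [(e0 j).2])⟩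
  have hli : LinearIndependent k v := by
    apply LinearIndependent.of_comp (gradedPiece k n d).subtype
    have := (basisMonomials (Fin (n + 1)) k).linearIndependent.comp
      (fun j => (e0 j : Fin (n + 1) →₀ ℕ)) (Subtype.val_injective.comp e0.injective)
    have h : (gradedPiece k n d).subtype ∘ v =
        (basisMonomials (Fin (n + 1)) k) ∘ fun j => (e0 j : Fin (n + 1) →₀ ℕ) := by
      funext j
      simp [v]
    rw [h]
    exact this
  have hsp : ⊤ ≤ Submodule.span k (Set.range v) := by
    rintro ⟨p, hp⟩ -
    have hp' := (mem_gp d p).1 hp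
    have : (⟨p, hp⟩ : gradedPiece k n d) = ∑ j, (coeff (e0 j : Fin (n + 1) →₀ ℕ) p) • v j := by
      apply Subtype.ext
      ext γ
      simp only [Submodule.coe_sum, Submodule.coe_smul, v, coeff_sum, coeff_smul, coeff_monomial,
        smul_eq_mul]
      by_cases hγ : ∑ i, γ i = d
      · rw [Finset.sum_eq_single (e0.symm ⟨γ, hγ⟩)]
        · simp
        · intro j _ hj
          rw [if_neg, mul_zero]
          intro h
          apply hj
          rw [Equiv.eq_symm_apply]
          exact Subtype.ext h
        · simp
      · rw [Finset.sum_eq_zero]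
        · by_contra h
          have := hp' h
          change Finsupp.weight (fun _ => 1) γ = d at this
          rw [← Finsupp.degree_eq_weight_one] at this
          exact hγ (by rw [← this, Finsupp.degree_eq_sum])
        · intro j _
          rw [if_neg, mul_zero]
          rintro h
          exact hγ (by rw [← h]; exact (e0 j).2)
    rw [this]
    exact Submodule.sum_mem _ fun j _ => Submodule.smul_mem _ _ (Submodule.subset_span ⟨j, rfl⟩)
  exact ⟨Module.Basis.mk hli hsp, fun j => by simp [v]⟩

theorem ιMulti_eq_det_smul {k W : Type*} [Field k] [AddCommGroup W] [Module k W] {N : ℕ}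
    (b : Module.Basis (Fin N) k W) (g : Fin N → W) :
    exteriorPower.ιMulti k N g = b.det g • exteriorPower.ιMulti k N b := by
  have : exteriorPower.ιMulti k N (M := W) =
      (LinearMap.toSpanSingleton k _ (exteriorPower.ιMulti k N b)).compAlternatingMap b.det := by
    refine Module.Basis.ext_alternating b fun i h => ?_
    let σ : Equiv.Perm (Fin N) := Equiv.ofBijective i (Finite.injective_iff_bijective.1 h)
    change exteriorPower.ιMulti k N (b ∘ σ) = ((LinearMap.toSpanSingleton k _
      (exteriorPower.ιMulti k N b)).compAlternatingMap b.det) (b ∘ σ)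
    rw [AlternatingMap.map_perm, AlternatingMap.map_perm]
    simp [Module.Basis.det_self]
  conv_lhs => rw [this]
  simp

theorem exists_pure {k W V : Type*} [Field k] [AddCommGroup W] [Module k W]
    [AddCommGroup V] [Module k V] {N : ℕ}
    (b : Module.Basis (Fin N) k W) (z : (⋀[k]^N W) ⊗[k] V) :
    ∃ φ : V, z = exteriorPower.ιMulti k N b ⊗ₜ[k] φ := by
  induction z with
  | zero => exact ⟨0, by simp⟩
  | add x y hx hy =>
    obtain ⟨φ, rfl⟩ := hx
    obtain ⟨ψ, rfl⟩ := hy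
    exact ⟨φ + ψ, by rw [TensorProduct.tmul_add]⟩
  | tmul w φ =>
    have hw : w ∈ Submodule.span k {exteriorPower.ιMulti k N b} := by
      have h1 : w ∈ (⊤ : Submodule k (⋀[k]^N W)) := trivial
      rw [← exteriorPower.ιMulti_span k N W] at h1
      refine (Submodule.span_le.2 ?_) h1
      rintro _ ⟨g, rfl⟩
      rw [ιMulti_eq_det_smul b g]
      exact Submodule.smul_mem _ _ (Submodule.mem_span_singleton_self _)
    obtain ⟨c, rfl⟩ := Submodule.mem_span_singleton.1 hw
    exact ⟨c • φ, by rw [TensorProduct.smul_tmul]⟩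

/-- The minor functional on exterior powers. -/
def minorFun {k W : Type*} [Field k] [AddCommGroup W] [Module k W] {M : ℕ}
    (f : Fin M → Module.Dual k W) : (⋀[k]^M W) →ₗ[k] k :=
  exteriorPower.alternatingMapLinearEquiv
    ((Matrix.detRowAlternating (n := Fin M) (R := k)).compLinearMap (LinearMap.pi f))

theorem minorFun_apply {k W : Type*} [Field k] [AddCommGroup W] [Module k W] {M : ℕ}
    (f : Fin M → Module.Dual k W) (g : Fin M → W) :
    minorFun f (exteriorPower.ιMulti k M g) = (Matrix.of fun i j => f j (g i)).det := by
  simp [minorFun]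
  rfl

/-- Laplace: the contraction of `g` against the minors is killed by each `f j`. -/
theorem laplace_zero {k W : Type*} [Field k] [AddCommGroup W] [Module k W] {M : ℕ}
    (f : Fin M → Module.Dual k W) (g : Fin (M + 1) → W) (j : Fin M) :
    ∑ t : Fin (M + 1), (-1 : k) ^ (t : ℕ) *
      minorFun f (exteriorPower.ιMulti k M fun s => g (t.succAbove s)) * f j (g t) = 0 := by
  let A : Matrix (Fin (M + 1)) (Fin (M + 1)) k :=
    Matrix.of fun i c => (Fin.cons (f j) f : Fin (M + 1) → Module.Dual k W) c (g i)
  have hA : A.det = 0 := by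
    apply Matrix.det_zero_of_column_eq (i := 0) (j := j.succ) (Fin.succ_ne_zero j).symm
    intro i
    simp [A]
  rw [Matrix.det_succ_column_zero] at hA
  rw [← hA]
  refine Finset.sum_congr rfl fun t _ => ?_
  rw [minorFun_apply]
  have : A.submatrix t.succAbove Fin.succ = Matrix.of fun i c => f c (g (t.succAbove i)) := by
    ext i c; simp [A]
  rw [this]
  simp [A]
  ring

/-- Divided differences are unique. -/
theorem IsDivDiff.unique {k : Type*} [Field k] {n : ℕ} {f : MvPolynomial (Fin (n + 1)) k}
    {j : Fin (n + 1)} {D D' : MvPolynomial (Fin (n + 1) ⊕ Fin (n + 1)) k}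
    (h : IsDivDiff k n f j D) (h' : IsDivDiff k n f j D') : D = D' := by
  have hne : (X (Sum.inl j) - X (Sum.inr j) : MvPolynomial (Fin (n + 1) ⊕ Fin (n + 1)) k) ≠ 0 := by
    rw [sub_ne_zero]
    intro h
    have := X_injective h
    simp at this
  exact mul_right_cancel₀ hne (h.trans h'.symm)

/-- The geometric factor. -/
def geo (k : Type*) [Field k] (n d : ℕ) (c : Fin (n + 1)) :
    MvPolynomial (Fin (n + 1) ⊕ Fin (n + 1)) k :=
  ∑ i ∈ Finset.range d, X (Sum.inl c) ^ i * X (Sum.inr c) ^ (d - 1 - i)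

theorem isDivDiff_pow (k : Type*) [Field k] (n d : ℕ) (s c : Fin (n + 1)) :
    IsDivDiff k n (monomial (Finsupp.single s d) 1) c (if c = s then geo k n d c else 0) := by
  unfold IsDivDiff
  have hm : (monomial (Finsupp.single s d) 1 : MvPolynomial (Fin (n + 1)) k) = X s ^ d := by
    rw [X_pow_eq_monomial]
  rw [hm]
  simp only [map_pow, aeval_X, mixv]
  by_cases h : c = s
  · subst h
    simp [geo, geom_sum₂_mul]
  · have h1 : ((s : ℕ) < (c : ℕ)) ↔ ((s : ℕ) < (c : ℕ) + 1) := by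
      have : (c : ℕ) ≠ (s : ℕ) := fun h' => h (Fin.ext h')
      omega
    simp only [h1, h, if_false, zero_mul, sub_self]

theorem coeffY_prod_geo (k : Type*) [Field k] (n d : ℕ) (β : Fin (n + 1) →₀ ℕ) :
    coeffY k n (∏ c, geo k n d c) β =
      if ∀ i, β i < d then
        monomial (Finsupp.equivFunOnFinite.symm fun i => d - 1 - β i) (1 : k) else 0 := by
  classical
  have h1 : sumAlgEquiv k (Fin (n + 1)) (Fin (n + 1)) (rename Sum.swap (∏ c, geo k n d c)) =
      ∑ p ∈ Fintype.piFinset (fun _ : Fin (n + 1) => Finset.range d),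
        monomial (Finsupp.equivFunOnFinite.symm fun i => d - 1 - p i)
          (monomial (Finsupp.equivFunOnFinite.symm p) (1 : k)) := by
    simp only [geo]
    rw [Finset.prod_univ_sum, map_sum, map_sum]
    refine Finset.sum_congr rfl fun p _ => ?_
    simp only [map_prod, map_mul, map_pow, rename_X, Sum.swap_inl, Sum.swap_inr,
      sumAlgEquiv_X_inl, sumAlgEquiv_X_inr]
    rw [Finset.prod_mul_distrib, monomial_eq, monomial_eq (s := Finsupp.equivFunOnFinite.symm p)]
    simp [Finsupp.prod_fintype]
  rw [coeffY, h1, coeff_sum]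
  simp only [coeff_monomial]
  split_ifs with h
  · rw [Finset.sum_eq_single (fun i => d - 1 - β i)]
    · rw [if_pos]
      ext i
      have := h i
      simp
      omega
    · intro p hp hne
      rw [if_neg]
      intro he
      apply hne
      ext i
      have h2 := DFunLike.congr_fun he i
      have h3 := Finset.mem_range.1 (Fintype.mem_piFinset.1 hp i)
      simp at h2
      omega
    · intro hp
      exfalso
      apply hp
      rw [Fintype.mem_piFinset]
      intro i
      have := h i
      rw [Finset.mem_range]
      omega
  · apply Finset.sum_eq_zero
    intro p hp
    rw [if_neg]
    intro he
    apply h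
    intro i
    have h2 := DFunLike.congr_fun he i
    have h3 := Finset.mem_range.1 (Fintype.mem_piFinset.1 hp i)
    simp at h2
    omega

theorem coeff_mul_eq_zero_of {k : Type*} [Field k] {n d : ℕ} {v p : MvPolynomial (Fin (n + 1)) k}
    (hv : v.IsHomogeneous d)
    (h0 : ∀ m : Fin (n + 1) →₀ ℕ, ∑ i, m i = d → (∀ i, m ≠ Finsupp.single i d) → coeff m v = 0)
    {γ : Fin (n + 1) →₀ ℕ} (hγ : ∀ i, γ i < d) : coeff γ (v * p) = 0 := by
  classical
  rw [coeff_mul]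
  apply Finset.sum_eq_zero
  rintro ⟨x, y⟩ hxy
  rw [Finset.HasAntidiagonal.mem_antidiagonal] at hxy
  simp only at hxy ⊢
  by_cases hx : coeff x v = 0
  · rw [hx, zero_mul]
  exfalso
  have hd := hv hx
  change Finsupp.weight (fun _ => 1) x = d at hd
  rw [← Finsupp.degree_eq_weight_one] at hd
  have hd' : ∑ i, x i = d := by rw [← hd, Finsupp.degree_eq_sum]
  apply hx
  apply h0 x hd'
  rintro i rfl
  have h1 := DFunLike.congr_fun hxy i
  have h2 := hγ i
  simp at h1
  omega

theorem coord_eq_coeff {k : Type*} [Field k] {n d : ℕ}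
    (e : Fin ((n + d).choose d) ≃ {m : Fin (n + 1) →₀ ℕ // ∑ i, m i = d})
    (b : Module.Basis (Fin ((n + d).choose d)) k (gradedPiece k n d))
    (hb : ∀ j, (b j : MvPolynomial (Fin (n + 1)) k) = monomial (e j : Fin (n + 1) →₀ ℕ) 1)
    (j : Fin ((n + d).choose d)) (g : gradedPiece k n d) :
    b.coord j g = coeff (e j : Fin (n + 1) →₀ ℕ) (g : MvPolynomial (Fin (n + 1)) k) := by
  classical
  have : b.coord j = (lcoeff k (e j : Fin (n + 1) →₀ ℕ)) ∘ₗ (gradedPiece k n d).subtype := by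
    refine b.ext fun i => ?_
    simp [hb, coeff_monomial, Finsupp.single_apply, Subtype.ext_iff.symm]
  rw [this]
  simp

/-- The minor functional on complementary basis wedges: off the diagonal. -/
theorem minor_compl_ne {k W : Type*} [Field k] [AddCommGroup W] [Module k W] {N M : ℕ}
    (b : Module.Basis (Fin N) k W) (I J : Finset (Fin N)) (hI : Iᶜ.card = M) (hJ : Jᶜ.card = M)
    (h : J ≠ I) :
    minorFun (fun t => b.coord (Iᶜ.orderIsoOfFin hI t))
      (exteriorPower.ιMulti k M fun t => b (Jᶜ.orderIsoOfFin hJ t)) = 0 := by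
  rw [minorFun_apply]
  have : ∃ x ∈ Iᶜ, x ∉ Jᶜ := by
    by_contra hcon
    push Not at hcon
    exact h (compl_injective (Finset.eq_of_subset_of_card_le hcon (by omega)).symm)
  obtain ⟨x, hx, hx'⟩ := this
  apply Matrix.det_eq_zero_of_column_eq_zero ((Iᶜ.orderIsoOfFin hI).symm ⟨x, hx⟩)
  intro i
  simp only [Matrix.of_apply, OrderIso.apply_symm_apply, Module.Basis.coord_apply,
    Module.Basis.repr_self]
  rw [Finsupp.single_apply, if_neg]
  rintro rfl
  exact hx' (Subtype.prop _)

theorem minor_compl_self {k W : Type*} [Field k] [AddCommGroup W] [Module k W] {N M : ℕ}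
    (b : Module.Basis (Fin N) k W) (I : Finset (Fin N)) (hI : Iᶜ.card = M) :
    minorFun (fun t => b.coord (Iᶜ.orderIsoOfFin hI t))
      (exteriorPower.ιMulti k M fun t => b (Iᶜ.orderIsoOfFin hI t)) = 1 := by
  rw [minorFun_apply]
  convert Matrix.det_one (n := Fin M) (R := k)
  ext i j
  simp [Finsupp.single_apply, Matrix.one_apply]

/-- The determinant of the matrix of divided differences of `x_{σ r}^d`. -/
theorem coeffY_det (k : Type*) [Field k] (n d : ℕ) (σ : Equiv.Perm (Fin (n + 1))) :
    ∃ ε : k, ε ≠ 0 ∧ ∀ β, coeffY k n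
      (Matrix.det (Matrix.of fun r c => if c = σ r then geo k n d c else 0)) β =
      ε • coeffY k n (∏ c, geo k n d c) β := by
  have h1 : (Matrix.of fun r c => if c = σ r then geo k n d c else 0) =
      (Matrix.diagonal (geo k n d)).submatrix σ id := by
    ext1 r c
    simp only [Matrix.of_apply, Matrix.submatrix_apply, Matrix.diagonal_apply, id]
    by_cases h : c = σ r
    · simp [h]
    · simp [h, Ne.symm h]
  rw [h1, Matrix.det_permute, Matrix.det_diagonal]
  rcases Int.units_eq_one_or (Equiv.Perm.sign σ) with h | h
  · exact ⟨1, one_ne_zero, fun β => by simp [h]⟩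
  · exact ⟨-1, by simp, fun β => by simp [h, coeffY]⟩

set_option maxHeartbeats 2000000

/-- Let `W = S_d`, `N = dim W`, `ρ = (n+1)(d−1)` and `0 ≤ ρ − a < d`.
If `B : ⋀^N W ⊗ (S_{ρ−a})^* → ⋀^{N−n−1} W ⊗ S_a` is the Bezoutian contraction map and
`β : ⋀^{N−n} W ⊗ S_{a−d} → ⋀^{N−n−1} W ⊗ S_a` is the Koszul contraction, then
`Im(B) ∩ Im(β) = {0}`. -/
theorem bezoutian_koszul_images_disjoint
    (k : Type*) [Field k] (n : ℕ) (d : ℕ) (hd : 1 ≤ d) (a : ℤ)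
    (ha₁ : 0 ≤ ((n + 1) * (d - 1) : ℤ) - a) (ha₂ : ((n + 1) * (d - 1) : ℤ) - a < d)
    (B : (↥(⋀[k]^((n + d).choose d) ↥(gradedPiece k n d)) ⊗[k]
            Module.Dual k ↥(gradedPiece k n (((n + 1) * (d - 1) : ℤ) - a))) →ₗ[k]
         (↥(⋀[k]^((n + d).choose d - n - 1) ↥(gradedPiece k n d)) ⊗[k]
            ↥(gradedPiece k n a)))
    (hB : ∀ (g : Fin ((n + d).choose d) → ↥(gradedPiece k n d))
        (φ : Module.Dual k ↥(gradedPiece k n (((n + 1) * (d - 1) : ℤ) - a)))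
        (w : ↥(⋀[k]^((n + d).choose d) ↥(gradedPiece k n d)))
        (_ : (w : ExteriorAlgebra k ↥(gradedPiece k n d)) =
              ExteriorAlgebra.ιMulti k ((n + d).choose d) g)
        (F : Finset (Fin ((n + d).choose d)) →
          ↥(⋀[k]^((n + d).choose d - n - 1) ↥(gradedPiece k n d)) ⊗[k] ↥(gradedPiece k n a)),
        (∀ (I : Finset (Fin ((n + d).choose d)))
            (hI : I.card = n + 1) (hc : Iᶜ.card = (n + d).choose d - n - 1)
            (Dm : Matrix (Fin (n + 1)) (Fin (n + 1)) (MvPolynomial (Fin (n + 1) ⊕ Fin (n + 1)) k)),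
            (∀ r c, IsDivDiff k n ((g (I.orderIsoOfFin hI r) : MvPolynomial (Fin (n + 1)) k))
              c (Dm r c)) →
            ∀ (wc : ↥(⋀[k]^((n + d).choose d - n - 1) ↥(gradedPiece k n d))),
              (wc : ExteriorAlgebra k ↥(gradedPiece k n d)) =
                ExteriorAlgebra.ιMulti k ((n + d).choose d - n - 1)
                  (fun t => g (Iᶜ.orderIsoOfFin hc t)) →
            ∀ (u : (Fin (n + 1) → ℕ) → ↥(gradedPiece k n (((n + 1) * (d - 1) : ℤ) - a)))
              (v : (Fin (n + 1) → ℕ) → ↥(gradedPiece k n a)),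
              (∀ β ∈ Finset.Nat.antidiagonalTuple (n + 1) a.toNat,
                ((u β : MvPolynomial (Fin (n + 1)) k) =
                    coeffY k n Dm.det (Finsupp.equivFunOnFinite.symm β)) ∧
                ((v β : MvPolynomial (Fin (n + 1)) k) =
                    monomial (Finsupp.equivFunOnFinite.symm β) (1 : k))) →
              F I = ((-1 : k) ^ ((∑ i ∈ I, (i : ℕ)) + n * (n + 1) / 2)) •
                (wc ⊗ₜ[k] ∑ β ∈ Finset.Nat.antidiagonalTuple (n + 1) a.toNat,
                  φ (u β) • v β)) →
        B (w ⊗ₜ[k] φ) = ∑ I ∈ Finset.powersetCard (n + 1) Finset.univ, F I)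
    (K : (↥(⋀[k]^((n + d).choose d - n) ↥(gradedPiece k n d)) ⊗[k]
            ↥(gradedPiece k n (a - d))) →ₗ[k]
         (↥(⋀[k]^((n + d).choose d - n - 1) ↥(gradedPiece k n d)) ⊗[k]
            ↥(gradedPiece k n a)))
    (hK : ∀ (s : ℕ) (hs : (n + d).choose d - n = s + 1)
        (g : Fin (s + 1) → ↥(gradedPiece k n d))
        (w : ↥(⋀[k]^((n + d).choose d - n) ↥(gradedPiece k n d)))
        (_ : (w : ExteriorAlgebra k ↥(gradedPiece k n d)) =
              ExteriorAlgebra.ιMulti k ((n + d).choose d - n) (fun t => g (Fin.cast hs t)))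
        (p : ↥(gradedPiece k n (a - d)))
        (w' : Fin (s + 1) → ↥(⋀[k]^((n + d).choose d - n - 1) ↥(gradedPiece k n d)))
        (_ : ∀ t, ((w' t : ExteriorAlgebra k ↥(gradedPiece k n d)) =
              ExteriorAlgebra.ιMulti k ((n + d).choose d - n - 1)
                (fun s' => g (t.succAbove (Fin.cast (by omega) s')))))
        (gp : Fin (s + 1) → ↥(gradedPiece k n a))
        (_ : ∀ t, (gp t : MvPolynomial (Fin (n + 1)) k) =
              (g t : MvPolynomial (Fin (n + 1)) k) * (p : MvPolynomial (Fin (n + 1)) k)),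
        K (w ⊗ₜ[k] p) = ∑ t : Fin (s + 1), (-1 : k) ^ (t : ℕ) • (w' t ⊗ₜ[k] gp t)) :
    LinearMap.range B ⊓ LinearMap.range K = ⊥ := by
  
  classical
  rcases lt_or_ge a 0 with ha | ha
  · have : Subsingleton (gradedPiece k n a) := by
      rw [gp_neg ha]; infer_instance
    have hz : ∀ z : (↥(⋀[k]^((n + d).choose d - n - 1) ↥(gradedPiece k n d)) ⊗[k]
            ↥(gradedPiece k n a)), z = 0 := by
      intro z
      induction z with
      | zero => rfl
      | add x y hx hy => rw [hx, hy, add_zero]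
      | tmul w p => rw [Subsingleton.elim p 0, TensorProduct.tmul_zero]
    rw [eq_bot_iff]
    intro z _
    rw [hz z]
    exact Submodule.zero_mem _
  obtain ⟨e, b, hb⟩ := exists_gp_basis k n d
  have hN : n + 1 ≤ (n + d).choose d := by
    have h1 : (n + d).choose d = (n + d).choose n := by
      rw [Nat.choose_symm_add]
    have h2 : (n + 1).choose n ≤ (n + d).choose n := Nat.choose_le_choose n (by omega)
    rw [h1]
    simpa using h2
  let ι0 : Fin (n + 1) → Fin ((n + d).choose d) := fun i =>
    e.symm ⟨Finsupp.single i d, by simp⟩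
  have hι0 : ∀ i, (e (ι0 i) : Fin (n + 1) →₀ ℕ) = Finsupp.single i d := by
    intro i; simp [ι0]
  have hinj : Function.Injective ι0 := by
    intro i j hij
    have h1 := hι0 i
    rw [hij, hι0 j] at h1
    exact ((Finsupp.single_left_inj (by omega)).1 h1).symm
  let I0 : Finset (Fin ((n + d).choose d)) := Finset.univ.image ι0
  have hI0 : I0.card = n + 1 := by
    rw [Finset.card_image_of_injective _ hinj]; simp
  have hc0 : I0ᶜ.card = (n + d).choose d - n - 1 := by
    rw [Finset.card_compl, hI0, Fintype.card_fin]; omega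
  let f : Fin ((n + d).choose d - n - 1) → Module.Dual k (gradedPiece k n d) :=
    fun t => b.coord (I0ᶜ.orderIsoOfFin hc0 t)
  let Θ : (Fin (n + 1) →₀ ℕ) → ((↥(⋀[k]^((n + d).choose d - n - 1) ↥(gradedPiece k n d)) ⊗[k]
            ↥(gradedPiece k n a)) →ₗ[k] k) := fun γ =>
    (TensorProduct.lid k k).toLinearMap ∘ₗ TensorProduct.map (minorFun f)
      ((lcoeff k γ) ∘ₗ (gradedPiece k n a).subtype)
  have hΘ : ∀ γ w p, Θ γ (w ⊗ₜ[k] p) =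
      minorFun f w * coeff γ (p : MvPolynomial (Fin (n + 1)) k) := by
    intro γ w p
    simp [Θ]
  -- the Koszul part
  have hΘK : ∀ γ : Fin (n + 1) →₀ ℕ, (∀ i, γ i < d) → ∀ y, Θ γ (K y) = 0 := by
    intro γ hγ y
    induction y with
    | zero => simp
    | add x y hx hy => rw [map_add, map_add, hx, hy, add_zero]
    | tmul w p =>
      have hlin : (Θ γ ∘ₗ K) ∘ₗ ((TensorProduct.mk k _ _).flip p) = 0 := by
        apply exteriorPower.linearMap_ext
        ext g
        have hs : (n + d).choose d - n = ((n + d).choose d - n - 1) + 1 := by omega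
        let g' : Fin (((n + d).choose d - n - 1) + 1) → gradedPiece k n d :=
          fun t => g (Fin.cast hs.symm t)
        have h1 := hK _ hs g' (exteriorPower.ιMulti k _ g) rfl p
          (fun t => exteriorPower.ιMulti k _ fun s => g' (t.succAbove s)) (fun t => rfl)
          (fun t => ⟨(g' t : MvPolynomial (Fin (n + 1)) k) * (p : MvPolynomial (Fin (n + 1)) k), mul_mem_gp (g' t).2 p.2⟩)
          (fun t => rfl)
        simp only [LinearMap.compAlternatingMap_apply, LinearMap.comp_apply, LinearMap.flip_apply,
          TensorProduct.mk_apply, LinearMap.zero_apply]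
        rw [h1, map_sum]
        simp only [map_smul, hΘ, smul_eq_mul]
        let v : gradedPiece k n d := ∑ t : Fin (((n + d).choose d - n - 1) + 1), ((-1 : k) ^ (t : ℕ) * minorFun f
          (exteriorPower.ιMulti k _ fun s => g' (t.succAbove s))) • g' t
        have hv : ∑ t : Fin (((n + d).choose d - n - 1) + 1), (-1 : k) ^ (t : ℕ) * (minorFun f
            (exteriorPower.ιMulti k _ fun s => g' (t.succAbove s)) *
            coeff γ ((g' t : MvPolynomial (Fin (n + 1)) k) * (p : MvPolynomial (Fin (n + 1)) k))) =
            coeff γ ((v : MvPolynomial (Fin (n + 1)) k) * (p : MvPolynomial (Fin (n + 1)) k)) := by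
          simp only [v, Submodule.coe_sum, Submodule.coe_smul, Finset.sum_mul, coeff_sum,
            smul_mul_assoc, coeff_smul, smul_eq_mul, mul_assoc]
        refine hv.trans ?_
        apply coeff_mul_eq_zero_of ((mem_gp d _).1 v.2) _ hγ
        intro m hm hms
        have hm2 : coeff m (v : MvPolynomial (Fin (n + 1)) k) = b.coord (e.symm ⟨m, hm⟩) v := by
          rw [coord_eq_coeff e b hb]; simp
        have hmem : e.symm ⟨m, hm⟩ ∈ I0ᶜ := by
          rw [Finset.mem_compl]
          intro hcon
          obtain ⟨i, -, hi⟩ := Finset.mem_image.1 hcon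
          have h3 := hι0 i
          rw [hi] at h3
          exact hms i (by simpa using h3)
        have hf : b.coord (e.symm ⟨m, hm⟩) = f ((I0ᶜ.orderIsoOfFin hc0).symm ⟨_, hmem⟩) := by
          simp only [f, OrderIso.apply_symm_apply]
        rw [hm2, hf]
        simp only [v, map_sum, map_smul, smul_eq_mul]
        exact laplace_zero f g' _
      exact LinearMap.congr_fun hlin w
  -- the Bezoutian part
  rw [eq_bot_iff]
  rintro x ⟨⟨z, rfl⟩, ⟨y, hy⟩⟩
  obtain ⟨φ, rfl⟩ := exists_pure b z
  suffices hφ : φ = 0 by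
    rw [hφ, TensorProduct.tmul_zero, map_zero]; exact Submodule.zero_mem _
  have hzero : ∀ γ : Fin (n + 1) →₀ ℕ, (∀ i, γ i < d) →
      Θ γ (B (exteriorPower.ιMulti k _ b ⊗ₜ[k] φ)) = 0 := by
    intro γ hγ
    rw [← hy]
    exact hΘK γ hγ y
  clear hK hΘK hy
  generalize hR : ((n + 1) * (d - 1) : ℤ) - a = R at *
  obtain ⟨r, rfl⟩ := Int.eq_ofNat_of_zero_le ha₁
  obtain ⟨a', rfl⟩ := Int.eq_ofNat_of_zero_le ha
  have hsum : r + a' = (n + 1) * (d - 1) := by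
    zify [hd]
    rw [← hR]; ring
  have hrd : r < d := by exact_mod_cast ha₂
  have hB1 := hB b φ (exteriorPower.ιMulti k _ b) rfl
  clear hB
  have hex : ∀ I : Finset (Fin ((n + d).choose d)),
      ∃ y : ↥(⋀[k]^((n + d).choose d - n - 1) ↥(gradedPiece k n d)) ⊗[k]
          ↥(gradedPiece k n (a' : ℤ)),
        (∀ (hI : I.card = n + 1) (hc : Iᶜ.card = (n + d).choose d - n - 1)
            (Dm : Matrix (Fin (n + 1)) (Fin (n + 1)) (MvPolynomial (Fin (n + 1) ⊕ Fin (n + 1)) k)),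
            (∀ r c, IsDivDiff k n ((b (I.orderIsoOfFin hI r) : MvPolynomial (Fin (n + 1)) k))
              c (Dm r c)) →
            ∀ (wc : ↥(⋀[k]^((n + d).choose d - n - 1) ↥(gradedPiece k n d))),
              (wc : ExteriorAlgebra k ↥(gradedPiece k n d)) =
                ExteriorAlgebra.ιMulti k ((n + d).choose d - n - 1)
                  (fun t => b (Iᶜ.orderIsoOfFin hc t)) →
            ∀ (u : (Fin (n + 1) → ℕ) → ↥(gradedPiece k n (r : ℤ)))
              (v : (Fin (n + 1) → ℕ) → ↥(gradedPiece k n (a' : ℤ))),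
              (∀ β ∈ Finset.Nat.antidiagonalTuple (n + 1) (a' : ℤ).toNat,
                ((u β : MvPolynomial (Fin (n + 1)) k) =
                    coeffY k n Dm.det (Finsupp.equivFunOnFinite.symm β)) ∧
                ((v β : MvPolynomial (Fin (n + 1)) k) =
                    monomial (Finsupp.equivFunOnFinite.symm β) (1 : k))) →
              y = ((-1 : k) ^ ((∑ i ∈ I, (i : ℕ)) + n * (n + 1) / 2)) •
                (wc ⊗ₜ[k] ∑ β ∈ Finset.Nat.antidiagonalTuple (n + 1) (a' : ℤ).toNat,
                  φ (u β) • v β)) ∧ (I ≠ I0 → ∀ γ, Θ γ y = 0) := by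
    intro I
    by_cases hP : ∃ (hI : I.card = n + 1) (hc : Iᶜ.card = (n + d).choose d - n - 1)
            (Dm : Matrix (Fin (n + 1)) (Fin (n + 1)) (MvPolynomial (Fin (n + 1) ⊕ Fin (n + 1)) k))
            (_ : ∀ r c, IsDivDiff k n ((b (I.orderIsoOfFin hI r) : MvPolynomial (Fin (n + 1)) k))
              c (Dm r c))
            (wc : ↥(⋀[k]^((n + d).choose d - n - 1) ↥(gradedPiece k n d)))
            (_ : (wc : ExteriorAlgebra k ↥(gradedPiece k n d)) =
                ExteriorAlgebra.ιMulti k ((n + d).choose d - n - 1)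
                  (fun t => b (Iᶜ.orderIsoOfFin hc t)))
            (u : (Fin (n + 1) → ℕ) → ↥(gradedPiece k n (r : ℤ)))
            (v : (Fin (n + 1) → ℕ) → ↥(gradedPiece k n (a' : ℤ))),
              (∀ β ∈ Finset.Nat.antidiagonalTuple (n + 1) (a' : ℤ).toNat,
                ((u β : MvPolynomial (Fin (n + 1)) k) =
                    coeffY k n Dm.det (Finsupp.equivFunOnFinite.symm β)) ∧
                ((v β : MvPolynomial (Fin (n + 1)) k) =
                    monomial (Finsupp.equivFunOnFinite.symm β) (1 : k)))
    · obtain ⟨hI, hc, Dm, hDm, wc, hwc, u, v, huv⟩ := hP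
      refine ⟨((-1 : k) ^ ((∑ i ∈ I, (i : ℕ)) + n * (n + 1) / 2)) •
                (wc ⊗ₜ[k] ∑ β ∈ Finset.Nat.antidiagonalTuple (n + 1) (a' : ℤ).toNat,
                  φ (u β) • v β), ?_, ?_⟩
      · intro hI' hc' Dm' hDm' wc' hwc' u' v' huv'
        obtain rfl : Dm = Dm' := by
          ext1 r c
          exact (hDm r c).unique (hDm' r c)
        obtain rfl : wc = wc' := Subtype.ext (hwc.trans hwc'.symm)
        congr 2
        refine Finset.sum_congr rfl fun β hβ => ?_
        have h1 : u β = u' β := Subtype.ext ((huv β hβ).1.trans (huv' β hβ).1.symm)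
        have h2 : v β = v' β := Subtype.ext ((huv β hβ).2.trans (huv' β hβ).2.symm)
        rw [h1, h2]
      · intro hne γ
        obtain rfl : wc = exteriorPower.ιMulti k _ fun t => b (Iᶜ.orderIsoOfFin hc t) :=
          Subtype.ext hwc
        rw [map_smul, hΘ, minor_compl_ne b I0 I hc0 hc hne, zero_mul, smul_zero]
    · refine ⟨0, ?_, fun _ γ => map_zero _⟩
      intro hI hc Dm hDm wc hwc u v huv
      exact absurd ⟨hI, hc, Dm, hDm, wc, hwc, u, v, huv⟩ hP
  choose F hF hF' using hex
  have hB2 := hB1 F hF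
  -- the permutation ordering the pure powers
  have hσ : ∀ t : Fin (n + 1), ∃ s, ι0 s = I0.orderIsoOfFin hI0 t := by
    intro t
    obtain ⟨s, -, hs⟩ := Finset.mem_image.1 (I0.orderIsoOfFin hI0 t).2
    exact ⟨s, hs⟩
  choose σ0 hσ0 using hσ
  have hσinj : Function.Injective σ0 := by
    intro s t hst
    have h1 := hσ0 s
    rw [hst, hσ0 t] at h1
    exact ((I0.orderIsoOfFin hI0).injective (Subtype.ext h1)).symm
  let σ : Equiv.Perm (Fin (n + 1)) :=
    Equiv.ofBijective σ0 (Finite.injective_iff_bijective.1 hσinj)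
  obtain ⟨ε, hε, hdet⟩ := coeffY_det k n d σ
  have hmemT : ∀ β : Fin (n + 1) → ℕ,
      β ∈ Finset.Nat.antidiagonalTuple (n + 1) (a' : ℤ).toNat ↔ ∑ i, β i = a' := by
    intro β; rw [Finset.Nat.mem_antidiagonalTuple]; simp
  have hcY : ∀ β : Fin (n + 1) → ℕ, ∑ i, β i = a' →
      coeffY k n (Matrix.det (Matrix.of fun r c => if c = σ r then geo k n d c else 0))
        (Finsupp.equivFunOnFinite.symm β) ∈ gradedPiece k n (r : ℤ) := by
    intro β hβ
    rw [hdet, coeffY_prod_geo]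
    apply Submodule.smul_mem
    split_ifs with h
    · apply monomial_mem_gp
      have h1 : ∑ i, (d - 1 - β i) + ∑ i, β i = (n + 1) * (d - 1) := by
        rw [← Finset.sum_add_distrib, Finset.sum_congr rfl (g := fun _ => d - 1)]
        · simp
        · intro i _
          have := h i
          simp at this
          omega
      simp only [Finsupp.equivFunOnFinite_symm_apply_apply]
      norm_cast
      omega
    · exact Submodule.zero_mem _
  have hF0 := hF I0 hI0 hc0
    (Matrix.of fun r c => if c = σ r then geo k n d c else 0)
    (by
      intro t c
      rw [hb, ← hσ0 t, hι0]
      exact isDivDiff_pow k n d _ c)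
    (exteriorPower.ιMulti k _ fun t => b (I0ᶜ.orderIsoOfFin hc0 t)) rfl
    (fun β => if h : ∑ i, β i = a' then ⟨_, hcY β h⟩ else 0)
    (fun β => if h : ∑ i, β i = a' then
      ⟨monomial (Finsupp.equivFunOnFinite.symm β) (1 : k), monomial_mem_gp _ _ (by simp [← h])⟩
      else 0)
    (by
      intro β hβ
      rw [hmemT] at hβ
      simp only [hβ, dif_pos]
      exact ⟨trivial, trivial⟩)
  obtain ⟨e', b', hb'⟩ := exists_gp_basis k n r
  refine b'.ext fun j => ?_
  rw [LinearMap.zero_apply]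
  have hαs := (e' j).2
  set α : Fin (n + 1) →₀ ℕ := (e' j : Fin (n + 1) →₀ ℕ) with hα
  have hαd : ∀ i, α i < d := fun i => lt_of_le_of_lt
    ((Finset.single_le_sum (f := fun i => α i) (fun _ _ => Nat.zero_le _) (Finset.mem_univ i)).trans
      hαs.le) hrd
  let γ0 : Fin (n + 1) → ℕ := fun i => d - 1 - α i
  have hγs : ∑ i, γ0 i = a' := by
    have h1 : ∑ i, γ0 i + ∑ i, α i = (n + 1) * (d - 1) := by
      rw [← Finset.sum_add_distrib, Finset.sum_congr rfl (g := fun _ => d - 1)]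
      · simp
      · intro i _
        have := hαd i
        simp only [γ0]
        omega
    omega
  have hγd : ∀ i, (Finsupp.equivFunOnFinite.symm γ0 : Fin (n + 1) →₀ ℕ) i < d := by
    intro i
    simp only [Finsupp.equivFunOnFinite_symm_apply_apply, γ0]
    omega
  have hfin := hzero (Finsupp.equivFunOnFinite.symm γ0) hγd
  rw [hB2, map_sum, Finset.sum_eq_single I0 (fun I _ hne => hF' I hne _)
    (fun h => absurd (by simp [Finset.mem_powersetCard, hI0]) h), hF0, map_smul, hΘ,
    minor_compl_self b I0 hc0, one_mul, smul_eq_mul] at hfin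
  have hfin2 := (mul_eq_zero.1 hfin).resolve_left (pow_ne_zero _ (by simp))
  rw [Submodule.coe_sum, coeff_sum, Finset.sum_eq_single γ0] at hfin2
  · simp only [hγs, dif_pos, Submodule.coe_smul, coeff_smul, coeff_monomial, if_true, smul_eq_mul,
      mul_one] at hfin2
    have hlast : (⟨_, hcY γ0 hγs⟩ : gradedPiece k n (r : ℤ)) = ε • b' j := by
      apply Subtype.ext
      rw [Submodule.coe_smul, hb', ← hα]
      simp only
      have hinv : (Finsupp.equivFunOnFinite.symm fun i => d - 1 -
          (Finsupp.equivFunOnFinite.symm γ0 : Fin (n + 1) →₀ ℕ) i) = α := by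
        ext i
        have := hαd i
        simp only [Finsupp.equivFunOnFinite_symm_apply_apply, γ0]
        omega
      rw [hdet, coeffY_prod_geo, if_pos hγd, hinv]
    rw [hlast, map_smul, smul_eq_mul] at hfin2
    exact (mul_eq_zero.1 hfin2).resolve_left hε
  · intro β hβ hne
    rw [hmemT] at hβ
    simp only [hβ, dif_pos, Submodule.coe_smul, coeff_smul, coeff_monomial, smul_eq_mul]
    rw [if_neg, mul_zero]
    intro h
    exact hne (Finsupp.equivFunOnFinite.symm.injective h)
  · intro h
    exact absurd ((hmemT _).2 hγs) h
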